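/- arXiv:1003.3871 — 5 statements merged into one kernel-verified Lean document; each statement's English description precedes it below -/
import Mathlib

section
/- (Auroux's Lemma.) Let G be a group, φ a central element of G, τ ∈ G, and let F = (τ₁,…,τ_m) be a tuple with product τ₁·τ₂⋯τ_m = φ. If there exists a tuple F' = (τ'₂,…,τ'_m) such that F is Hurwitz equivalent to the tuple (τ, τ'₂,…,τ'_m), then the simultaneously conjugated tuple F^τ = (τ⁻¹τ₁τ,…,τ⁻¹τ_mτ) is Hurwitz equivalent to F. -/
/-- A single Hurwitz move: replace consecutive entries `(x, y)` by `(x*y*x⁻¹, x)`. -/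
inductive HurwitzStep {G : Type*} [Group G] : List G → List G → Prop
  | move (l₁ l₂ : List G) (x y : G) :
      HurwitzStep (l₁ ++ x :: y :: l₂) (l₁ ++ (x * y * x⁻¹) :: x :: l₂)

/-- Hurwitz equivalence: a finite sequence of Hurwitz moves and inverse Hurwitz moves. -/
def HurwitzEquiv {G : Type*} [Group G] : List G → List G → Prop :=
  Relation.ReflTransGen (fun a b => HurwitzStep a b ∨ HurwitzStep b a)

namespace HurwitzEquiv

variable {G : Type*} [Group G] {a b : List G}

theorem of_step (h : HurwitzStep a b) : HurwitzEquiv a b :=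
  Relation.ReflTransGen.single (Or.inl h)

theorem symm (h : HurwitzEquiv a b) : HurwitzEquiv b a :=
  have : Std.Symm (fun a b : List G => HurwitzStep a b ∨ HurwitzStep b a) := ⟨fun _ _ => Or.symm⟩
  Relation.ReflTransGen.stdSymm.symm _ _ h

theorem cons (g : G) (h : HurwitzEquiv a b) : HurwitzEquiv (g :: a) (g :: b) := by
  have step : ∀ {c d : List G}, HurwitzStep c d → HurwitzStep (g :: c) (g :: d) := by
    rintro _ _ ⟨l₁, l₂, x, y⟩
    exact .move (g :: l₁) l₂ x y
  exact Relation.ReflTransGen.lift (g :: ·) (fun _ _ h => h.imp step step) _ _ h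

theorem map {H : Type*} [Group H] (f : G →* H) (h : HurwitzEquiv a b) :
    HurwitzEquiv (a.map f) (b.map f) := by
  have step : ∀ {c d : List G}, HurwitzStep c d → HurwitzStep (c.map f) (d.map f) := by
    rintro _ _ ⟨l₁, l₂, x, y⟩
    simpa using HurwitzStep.move (l₁.map f) (l₂.map f) (f x) (f y)
  exact Relation.ReflTransGen.lift (List.map f) (fun _ _ h => h.imp step step) _ _ h

theorem prod_eq (h : HurwitzEquiv a b) : a.prod = b.prod := by
  have step : ∀ {c d : List G}, HurwitzStep c d → c.prod = d.prod := by
    rintro _ _ ⟨l₁, l₂, x, y⟩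
    simp [mul_assoc]
  induction h with
  | refl => rfl
  | tail _ h ih => exact ih.trans (h.elim step fun h => (step h).symm)

/-- The first entry can be moved to the end, conjugating the entries it passes. -/
theorem cons_map_conj (t : G) (l : List G) :
    HurwitzEquiv (t :: l.map (fun x => t⁻¹ * x * t)) (l ++ [t]) := by
  induction l with
  | nil => exact .refl
  | cons y l ih =>
    have h := HurwitzStep.move [] (l.map (fun x => t⁻¹ * x * t)) t (t⁻¹ * y * t)
    have e : t * (t⁻¹ * y * t) * t⁻¹ = y := by group
    rw [e] at h
    exact (of_step h).trans (ih.cons y)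

/-- The last entry can be moved to the front, where it is conjugated by the product of the
entries it passes. -/
theorem append_singleton (l : List G) (t : G) :
    HurwitzEquiv (l ++ [t]) ((l.prod * t * l.prod⁻¹) :: l) := by
  induction l with
  | nil => simpa using show HurwitzEquiv [t] [t] from .refl
  | cons y l ih =>
    have h := HurwitzStep.move [] l y (l.prod * t * l.prod⁻¹)
    have e : y * (l.prod * t * l.prod⁻¹) * y⁻¹ = (y :: l).prod * t * (y :: l).prod⁻¹ := by
      simp [mul_assoc]
    rw [e] at h
    exact (ih.cons y).trans (of_step h)

end HurwitzEquiv

/-- **Auroux's Lemma.** If `F` is a factorization of a central element `φ` and `F` is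
Hurwitz equivalent to a factorization beginning with `τ`, then the simultaneous
conjugate `F^τ` is Hurwitz equivalent to `F`. -/
theorem auroux_lemma {G : Type*} [Group G] (F : List G) (φ τ : G)
    (hprod : F.prod = φ) (hcentral : ∀ x : G, φ * x = x * φ)
    (hF : ∃ F' : List G, HurwitzEquiv F (τ :: F')) :
    HurwitzEquiv (F.map (fun x => τ⁻¹ * x * τ)) F := by
  obtain ⟨F', h⟩ := hF
  have hp : F'.prod = τ⁻¹ * φ := by
    rw [← hprod, h.prod_eq, List.prod_cons, inv_mul_cancel_left]
  have hfix : F'.prod * τ * F'.prod⁻¹ = τ := by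
    rw [mul_inv_eq_iff_eq_mul, hp, mul_assoc, hcentral]
    group
  have hconj : HurwitzEquiv (F.map (fun x => τ⁻¹ * x * τ))
      (τ :: F'.map (fun x => τ⁻¹ * x * τ)) := by
    have e : (fun x => τ⁻¹ * x * τ) = (MulAut.conj τ⁻¹).toMonoidHom := by
      ext x
      simp
    have hm := h.map (MulAut.conj τ⁻¹).toMonoidHom
    rw [← e] at hm
    simpa using hm
  have hrot := HurwitzEquiv.append_singleton F' τ
  rw [hfix] at hrot
  exact ((hconj.trans (HurwitzEquiv.cons_map_conj τ F')).trans hrot).trans h.symm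
end

section
/- Let G be a group, B ⊆ G a subset, and let F = (α₁,…,α_m) and F' = (α'₁,…,α'_{m'}) be tuples of elements of G that are stably equivalent with respect to B. Let Ĥ be the subgroup of G generated by the entries of F together with B (which equals the subgroup generated by the entries of F' together with B). Then for every element h ∈ Ĥ that is NOT conjugate in Ĥ to its inverse h⁻¹, the signed count #{i : α_i is conjugate to h in Ĥ} − #{i : α_i is conjugate to h⁻¹ in Ĥ} equals the corresponding signed count #{i : α'_i is conjugate to h in Ĥ} − #{i : α'_i is conjugate to h⁻¹ in Ĥ}. -/
/-- A creation step with respect to `B`: insert two consecutive entries `(β, β⁻¹)`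
with `β ∈ B`. -/
inductive CreationStep {G : Type*} [Group G] (B : Set G) : List G → List G → Prop
  | create (l₁ l₂ : List G) (β : G) (hβ : β ∈ B) :
      CreationStep B (l₁ ++ l₂) (l₁ ++ β :: β⁻¹ :: l₂)

/-- Stable equivalence with respect to `B`: Hurwitz moves, inverse Hurwitz moves,
and creations/cancellations of consecutive pairs `(β, β⁻¹)` with `β ∈ B`. -/
def StableEquiv {G : Type*} [Group G] (B : Set G) : List G → List G → Prop :=
  Relation.ReflTransGen (fun a b => HurwitzStep a b ∨ HurwitzStep b a ∨
    CreationStep B a b ∨ CreationStep B b a)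

open Classical in
theorem card_subtype_get_eq_sum_map {α : Type*} (p : α → Prop) (l : List α) :
    (Nat.card {i : Fin l.length // p (l.get i)} : ℤ) =
      (l.map fun x => if p x then (1 : ℤ) else 0).sum := by
  rw [Nat.card_eq_fintype_card, Fintype.card_subtype, Finset.card_filter]
  push_cast
  simp [← Fin.sum_univ_fun_getElem]

theorem list_sum_map_sub {α M : Type*} [AddCommGroup M] (l : List α) (f g : α → M) :
    (l.map fun x => f x - g x).sum = (l.map f).sum - (l.map g).sum := by
  simpa only [Multiset.map_coe, Multiset.sum_coe] using
    Multiset.sum_map_sub (m := (l : Multiset α)) (f := f) (g := g)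

section

variable {G M : Type*} [Group G] [AddCommGroup M] {B : Set G} {H : Subgroup G} {f : G → M}
  {a b : List G}

theorem HurwitzStep.forall_mem_iff (hs : HurwitzStep a b) :
    (∀ x ∈ a, x ∈ H) ↔ ∀ x ∈ b, x ∈ H := by
  obtain ⟨l₁, l₂, x, y⟩ := hs
  have key (hx : x ∈ H) : x * y * x⁻¹ ∈ H ↔ y ∈ H := by
    rw [H.mul_mem_cancel_right (H.inv_mem hx), H.mul_mem_cancel_left hx]
  simp only [List.forall_mem_append, List.forall_mem_cons]
  tauto

theorem HurwitzStep.sum_map_eq (hs : HurwitzStep a b) (ha : ∀ x ∈ a, x ∈ H)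
    (hf : ∀ x ∈ H, ∀ y, f (x * y * x⁻¹) = f y) : (a.map f).sum = (b.map f).sum := by
  obtain ⟨l₁, l₂, x, y⟩ := hs
  simp only [List.map_append, List.map_cons, List.sum_append, List.sum_cons,
    hf x (ha x (by simp)) y]
  abel

theorem CreationStep.forall_mem_iff (hs : CreationStep B a b) (hB : B ⊆ H) :
    (∀ x ∈ a, x ∈ H) ↔ ∀ x ∈ b, x ∈ H := by
  obtain ⟨l₁, l₂, β, hβ⟩ := hs
  have hβH : β ∈ H := hB hβ
  simp only [List.forall_mem_append, List.forall_mem_cons, H.inv_mem_iff, hβH, true_and]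

theorem CreationStep.sum_map_eq (hs : CreationStep B a b) (hf : ∀ x, f x + f x⁻¹ = 0) :
    (a.map f).sum = (b.map f).sum := by
  obtain ⟨l₁, l₂, β, hβ⟩ := hs
  simp only [List.map_append, List.map_cons, List.sum_append, List.sum_cons]
  rw [← add_assoc (f β), hf, zero_add]

/-- An odd function invariant under conjugation by `H` has a stably invariant sum over
factorizations with entries in `H`. -/
theorem StableEquiv.sum_map_eq (hs : StableEquiv B a b) (hB : B ⊆ H) (ha : ∀ x ∈ a, x ∈ H)
    (hconj : ∀ x ∈ H, ∀ y, f (x * y * x⁻¹) = f y) (hodd : ∀ x, f x + f x⁻¹ = 0) :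
    (a.map f).sum = (b.map f).sum := by
  suffices h : (∀ x ∈ b, x ∈ H) ∧ (a.map f).sum = (b.map f).sum from h.2
  induction hs with
  | refl => exact ⟨ha, rfl⟩
  | tail _ step ih =>
    obtain ⟨hmem, hsum⟩ := ih
    rw [hsum]
    rcases step with h | h | h | h
    · exact ⟨h.forall_mem_iff.1 hmem, h.sum_map_eq hmem hconj⟩
    · have hmem' := h.forall_mem_iff.2 hmem
      exact ⟨hmem', (h.sum_map_eq hmem' hconj).symm⟩
    · exact ⟨(h.forall_mem_iff hB).1 hmem, h.sum_map_eq hodd⟩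
    · exact ⟨(h.forall_mem_iff hB).2 hmem, (h.sum_map_eq hodd).symm⟩

theorem exists_mem_conj_eq_conj_iff (h : G) {x : G} (hx : x ∈ H) (y : G) :
    (∃ k ∈ H, x * y * x⁻¹ = k⁻¹ * h * k) ↔ ∃ k ∈ H, y = k⁻¹ * h * k := by
  constructor
  · rintro ⟨k, hk, e⟩
    refine ⟨k * x, H.mul_mem hk hx, ?_⟩
    calc y = x⁻¹ * (x * y * x⁻¹) * x := by group
      _ = _ := by rw [e]; group
  · rintro ⟨k, hk, rfl⟩
    exact ⟨k * x⁻¹, H.mul_mem hk (H.inv_mem hx), by group⟩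

theorem exists_mem_inv_eq_conj_iff (h y : G) :
    (∃ k ∈ H, y⁻¹ = k⁻¹ * h * k) ↔ ∃ k ∈ H, y = k⁻¹ * h⁻¹ * k := by
  refine exists_congr fun k => and_congr_right fun _ => ?_
  rw [inv_eq_iff_eq_inv]
  simp [mul_assoc]

end



/-- For stably equivalent factorizations, and `Hhat` the stabilized monodromy group,
the signed count of entries in the `Hhat`-conjugacy class of an element `h ∈ Hhat` not
conjugate in `Hhat` to its inverse is an invariant. -/
theorem stable_signed_count_invariant {G : Type*} [Group G] (B : Set G) (F F' : List G)
    (hFF' : StableEquiv B F F')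
    (Hhat : Subgroup G) (hHhat : Hhat = Subgroup.closure ({x | x ∈ F} ∪ B))
    (h : G) (hh : h ∈ Hhat) (hnc : ¬ ∃ k ∈ Hhat, h⁻¹ = k⁻¹ * h * k) :
    (Nat.card {i : Fin F.length // ∃ k ∈ Hhat, F.get i = k⁻¹ * h * k} : ℤ) -
        Nat.card {i : Fin F.length // ∃ k ∈ Hhat, F.get i = k⁻¹ * h⁻¹ * k} =
      (Nat.card {i : Fin F'.length // ∃ k ∈ Hhat, F'.get i = k⁻¹ * h * k} : ℤ) -
        Nat.card {i : Fin F'.length // ∃ k ∈ Hhat, F'.get i = k⁻¹ * h⁻¹ * k} := by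
  classical
  subst hHhat
  set H := Subgroup.closure ({x | x ∈ F} ∪ B) with hH
  have hF : ∀ x ∈ F, x ∈ H := fun x hx => Subgroup.subset_closure (Or.inl hx)
  have hB : B ⊆ H := fun x hx => Subgroup.subset_closure (Or.inr hx)
  simp only [card_subtype_get_eq_sum_map fun x => ∃ k ∈ H, x = k⁻¹ * h * k,
    card_subtype_get_eq_sum_map fun x => ∃ k ∈ H, x = k⁻¹ * h⁻¹ * k, ← list_sum_map_sub]
  refine hFF'.sum_map_eq hB hF (fun x hx y => ?_) fun x => ?_
  · simp only [exists_mem_conj_eq_conj_iff _ hx]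
  · simp only [exists_mem_inv_eq_conj_iff, inv_inv]
    ring
end

section
/- Let b, d ≥ 1 and n = 4b + 4d. Let (τ₁,…,τ_n) and (τ'₁,…,τ'_n) be two n-tuples of permutations in S₄ such that for every i ≤ 4b both τ_i and τ'_i belong to {(1 2), (3 4)}, and for every i with 4b < i ≤ n both τ_i and τ'_i belong to {(1 3), (2 4)}. If the ordered products coincide, τ₁·τ₂⋯τ_n = τ'₁·τ'₂⋯τ'_n, then the number of indices i with τ_i ≠ τ'_i is even. -/
open Equiv

/-- Two words in a pair of commuting involutions `x`, `y` have products differing by the power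
of `x * y` counting the positions where they disagree. -/
theorem prod_ofFn_eq_mul_pow_discrepancies {G : Type*} [Group G] [DecidableEq G] {x y : G}
    (hx : x * x = 1) (hy : y * y = 1) (hxy : Commute x y) :
    ∀ {m : ℕ} (f g : Fin m → G), (∀ i, f i = x ∨ f i = y) → (∀ i, g i = x ∨ g i = y) →
      (List.ofFn f).prod =
        (List.ofFn g).prod * (x * y) ^ (∑ i, if f i ≠ g i then 1 else 0)
  | 0, _, _, _, _ => by simp
  | m + 1, f, g, hf, hg => by
    have ih := prod_ofFn_eq_mul_pow_discrepancies hx hy hxy (fun i => f i.succ)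
      (fun i => g i.succ) (fun i => hf i.succ) (fun i => hg i.succ)
    have hcomm : Commute (x * y) (List.ofFn fun i => g i.succ).prod := by
      refine Commute.list_prod_right _ _ fun z hz => ?_
      obtain ⟨i, rfl⟩ := (List.mem_ofFn' _ _).1 hz
      rcases hg i.succ with h | h <;> simp only [h]
      · exact (Commute.refl x).mul_left hxy.symm
      · exact hxy.mul_left (Commute.refl y)
    have h0 : f 0 = g 0 * (x * y) ^ (if f 0 ≠ g 0 then 1 else 0) := by
      split_ifs with h
      · rcases hf 0 with h1 | h1 <;> rcases hg 0 with h2 | h2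
        · exact absurd (h1.trans h2.symm) h
        · rw [h1, h2, pow_one, hxy.eq, ← mul_assoc, hy, one_mul]
        · rw [h1, h2, pow_one, ← mul_assoc, hx, one_mul]
        · exact absurd (h1.trans h2.symm) h
      · simpa using h
    rw [List.ofFn_succ, List.ofFn_succ, List.prod_cons, List.prod_cons, Fin.sum_univ_succ,
      pow_add, ih, mul_assoc (g 0), ← mul_assoc (List.prod _) ((x * y) ^ _),
      ← (hcomm.pow_left (if f 0 ≠ g 0 then 1 else 0)).eq, mul_assoc (_ ^ _),
      ← mul_assoc (g 0), ← h0]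

/-- A word of length divisible by four in two commuting involutions `x`, `y` is a power of
`x * y`. -/
theorem exists_prod_ofFn_eq_pow {G : Type*} [Group G] {x y : G}
    (hx : x * x = 1) (hy : y * y = 1) (hxy : Commute x y) {k : ℕ} (f : Fin (4 * k) → G)
    (hf : ∀ i, f i = x ∨ f i = y) : ∃ e : ℕ, (List.ofFn f).prod = (x * y) ^ e := by
  classical
  have h4 : x ^ 4 = 1 := by
    rw [show 4 = 2 * 2 from rfl, pow_mul, pow_two x, hx, one_pow]
  have h := prod_ofFn_eq_mul_pow_discrepancies hx hy hxy f (fun _ => x) hf fun _ => Or.inl rfl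
  rw [List.ofFn_const, List.prod_replicate, pow_mul, h4, one_pow, one_mul] at h
  exact ⟨_, h⟩

/-- The double transpositions `(0 1)(2 3)` and `(0 2)(1 3)` are independent modulo two. -/
theorem even_and_even_of_pow_mul_pow_eq_one {p q : ℕ}
    (h : (swap 0 1 * swap 2 3 : Perm (Fin 4)) ^ p * (swap 0 2 * swap 1 3) ^ q = 1) :
    Even p ∧ Even q := by
  have hu : (swap 0 1 * swap 2 3 : Perm (Fin 4)) ^ 2 = 1 := by decide
  have hv : (swap 0 2 * swap 1 3 : Perm (Fin 4)) ^ 2 = 1 := by decide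
  rw [pow_eq_pow_mod p hu, pow_eq_pow_mod q hv] at h
  rw [Nat.even_iff, Nat.even_iff]
  rcases Nat.mod_two_eq_zero_or_one p with hp | hp <;>
    rcases Nat.mod_two_eq_zero_or_one q with hq | hq <;> rw [hp, hq] at h ⊢
  · exact ⟨rfl, rfl⟩
  all_goals exact absurd h (by decide)

/-- Parity invariant: two tuples of transpositions in `S₄`, whose first `4b` entries lie
in `{(1 2), (3 4)}` and remaining `4d` entries lie in `{(1 3), (2 4)}`, having the same
ordered product, differ in an even number of positions. -/
theorem parity_of_discrepancies (b d : ℕ) (hb : 1 ≤ b) (hd : 1 ≤ d)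
    (n : ℕ) (hn : n = 4 * b + 4 * d)
    (τ τ' : Fin n → Equiv.Perm (Fin 4))
    (hτ₁ : ∀ i : Fin n, (i : ℕ) < 4 * b →
      (τ i = Equiv.swap 0 1 ∨ τ i = Equiv.swap 2 3) ∧
      (τ' i = Equiv.swap 0 1 ∨ τ' i = Equiv.swap 2 3))
    (hτ₂ : ∀ i : Fin n, 4 * b ≤ (i : ℕ) →
      (τ i = Equiv.swap 0 2 ∨ τ i = Equiv.swap 1 3) ∧
      (τ' i = Equiv.swap 0 2 ∨ τ' i = Equiv.swap 1 3))
    (hprod : (List.ofFn τ).prod = (List.ofFn τ').prod) :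
    Even (Nat.card {i : Fin n // τ i ≠ τ' i}) := by
  subst hn
  have hf : ∀ i : Fin (4 * b), _ := fun i => hτ₁ (Fin.castAdd (4 * d) i) i.isLt
  have hg : ∀ i : Fin (4 * d), _ := fun i => hτ₂ (Fin.natAdd (4 * b) i) (Nat.le_add_right _ _)
  have hx : (swap 0 1 : Perm (Fin 4)) * swap 0 1 = 1 := swap_mul_self _ _
  have hy : (swap 2 3 : Perm (Fin 4)) * swap 2 3 = 1 := swap_mul_self _ _
  have hxy : Commute (swap 0 1 : Perm (Fin 4)) (swap 2 3) := by
    unfold Commute SemiconjBy; decide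
  have hz : (swap 0 2 : Perm (Fin 4)) * swap 0 2 = 1 := swap_mul_self _ _
  have hw : (swap 1 3 : Perm (Fin 4)) * swap 1 3 = 1 := swap_mul_self _ _
  have hzw : Commute (swap 0 2 : Perm (Fin 4)) (swap 1 3) := by
    unfold Commute SemiconjBy; decide
  have huv : Commute (swap 0 1 * swap 2 3 : Perm (Fin 4)) (swap 0 2 * swap 1 3) := by
    unfold Commute SemiconjBy; decide
  have split (σ : Fin (4 * b + 4 * d) → Perm (Fin 4)) : (List.ofFn σ).prod =
      (List.ofFn fun i => σ (Fin.castAdd (4 * d) i)).prod *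
        (List.ofFn fun i => σ (Fin.natAdd (4 * b) i)).prod := by
    rw [← List.prod_append, ← List.ofFn_fin_append, Fin.append_castAdd_natAdd]
  obtain ⟨e, he⟩ := exists_prod_ofFn_eq_pow hz hw hzw _ fun i => (hg i).2
  rw [split τ, split τ',
    prod_ofFn_eq_mul_pow_discrepancies hx hy hxy _ _ (fun i => (hf i).1) (fun i => (hf i).2),
    prod_ofFn_eq_mul_pow_discrepancies hz hw hzw _ _ (fun i => (hg i).1) (fun i => (hg i).2),
    he, mul_assoc, mul_right_inj, ← mul_assoc, (huv.pow_pow _ _).eq, mul_assoc,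
    mul_eq_left] at hprod
  obtain ⟨h₁, h₂⟩ := even_and_even_of_pow_mul_pow_eq_one hprod
  rw [Nat.card_eq_fintype_card, Fintype.card_subtype, Finset.card_filter, Fin.sum_univ_add]
  exact h₁.add h₂
end

section
/- Define the Hurwitz move m_i (i = 1, 2, 3) on 4-tuples (τ₁,τ₂,τ₃,τ₄) of permutations in S₄ by replacing (τ_i, τ_{i+1}) with (τ_i τ_{i+1} τ_i⁻¹, τ_i), and its inverse m_i⁻¹ by replacing (τ_i, τ_{i+1}) with (τ_{i+1}, τ_{i+1}⁻¹ τ_i τ_{i+1}). Let Φ be the transformation of 4-tuples obtained by applying, in order: m₂; then m₁ twice; then m₃ twice; then m₂; then m₃⁻¹ twice; then m₁⁻¹ twice; then m₂⁻¹ (this is the Hurwitz action of the 'snake' half twist σ_s = σ₂(σ₁²σ₃²)σ₂(σ₃⁻²σ₁⁻²)σ₂⁻¹). Then for every 4-tuple (τ₁,τ₂,τ₃,τ₄) with τ₁, τ₂ ∈ {(1 2), (3 4)} and τ₃, τ₄ ∈ {(1 3), (2 4)}: (1) if the product τ₁τ₂τ₃τ₄ is the identity or equals π = (1 4)(2 3),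 then Φ fixes the tuple; (2) otherwise, Φ replaces each entry τ_i by π τ_i π. -/
open Equiv

namespace SnakeTwist

abbrev S4 := Equiv.Perm (Fin 4)

/-- Hurwitz move at position 1 on a 4-tuple. -/
def m1 (t : S4 × S4 × S4 × S4) : S4 × S4 × S4 × S4 :=
  (t.1 * t.2.1 * t.1⁻¹, t.1, t.2.2.1, t.2.2.2)

/-- Hurwitz move at position 2 on a 4-tuple. -/
def m2 (t : S4 × S4 × S4 × S4) : S4 × S4 × S4 × S4 :=
  (t.1, t.2.1 * t.2.2.1 * t.2.1⁻¹, t.2.1, t.2.2.2)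

/-- Hurwitz move at position 3 on a 4-tuple. -/
def m3 (t : S4 × S4 × S4 × S4) : S4 × S4 × S4 × S4 :=
  (t.1, t.2.1, t.2.2.1 * t.2.2.2 * t.2.2.1⁻¹, t.2.2.1)

/-- Inverse Hurwitz move at position 1. -/
def m1inv (t : S4 × S4 × S4 × S4) : S4 × S4 × S4 × S4 :=
  (t.2.1, t.2.1⁻¹ * t.1 * t.2.1, t.2.2.1, t.2.2.2)

/-- Inverse Hurwitz move at position 2. -/
def m2inv (t : S4 × S4 × S4 × S4) : S4 × S4 × S4 × S4 :=
  (t.1, t.2.2.1, t.2.2.1⁻¹ * t.2.1 * t.2.2.1, t.2.2.2)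

/-- Inverse Hurwitz move at position 3. -/
def m3inv (t : S4 × S4 × S4 × S4) : S4 × S4 × S4 × S4 :=
  (t.1, t.2.1, t.2.2.2, t.2.2.2⁻¹ * t.2.2.1 * t.2.2.2)

/-- The Hurwitz action of the snake half twist
`σ_s = σ₂ (σ₁² σ₃²) σ₂ (σ₃⁻² σ₁⁻²) σ₂⁻¹`:
apply in order `m₂; m₁; m₁; m₃; m₃; m₂; m₃⁻¹; m₃⁻¹; m₁⁻¹; m₁⁻¹; m₂⁻¹`. -/
def Φ (t : S4 × S4 × S4 × S4) : S4 × S4 × S4 × S4 :=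
  m2inv (m1inv (m1inv (m3inv (m3inv (m2 (m3 (m3 (m1 (m1 (m2 t))))))))))

/-- The double transposition `π = (1 4)(2 3)`. -/
def π : S4 := Equiv.swap 0 3 * Equiv.swap 1 2

/-- Action of the snake half twist on admissible 4-tuples: it fixes the tuple if
`τ₁τ₂τ₃τ₄` is trivial or equals `π`, and otherwise conjugates every entry by `π`. -/
theorem snake_action (τ₁ τ₂ τ₃ τ₄ : S4)
    (h₁ : τ₁ = Equiv.swap 0 1 ∨ τ₁ = Equiv.swap 2 3)
    (h₂ : τ₂ = Equiv.swap 0 1 ∨ τ₂ = Equiv.swap 2 3)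
    (h₃ : τ₃ = Equiv.swap 0 2 ∨ τ₃ = Equiv.swap 1 3)
    (h₄ : τ₄ = Equiv.swap 0 2 ∨ τ₄ = Equiv.swap 1 3) :
    ((τ₁ * τ₂ * τ₃ * τ₄ = 1 ∨ τ₁ * τ₂ * τ₃ * τ₄ = π) →
      Φ (τ₁, τ₂, τ₃, τ₄) = (τ₁, τ₂, τ₃, τ₄)) ∧
    (¬ (τ₁ * τ₂ * τ₃ * τ₄ = 1 ∨ τ₁ * τ₂ * τ₃ * τ₄ = π) →
      Φ (τ₁, τ₂, τ₃, τ₄) = (π * τ₁ * π, π * τ₂ * π, π * τ₃ * π, π * τ₄ * π)) := by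
  rcases h₁ with rfl | rfl <;> rcases h₂ with rfl | rfl <;> rcases h₃ with rfl | rfl <;>
    rcases h₄ with rfl | rfl <;> decide +kernel

end SnakeTwist
end

section
/- Let a, b, c, d, a', b', c', d' be positive integers satisfying: (i) ab + cd = a'b' + c'd'; (ii) (a+c−2)(b+d−2) = (a'+c'−2)(b'+d'−2); (iii) 4ab − (ad + bc) = 4a'b' − (a'd' + b'c'); and (iv) 4cd − (ad + bc) = 4c'd' − (a'd' + b'c'). Then ab = a'b', cd = c'd', ad + bc = a'd' + b'c', and, up to swapping, the sums agree: either (a+c = a'+c' and b+d = b'+d') or (a+c = b'+d' and b+d = a'+c'). -/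
/-- Arithmetic core of the Main Theorem on abcd-surfaces: equality of χ, K², and of
the weighted counts of full-twist factors of types p and q forces `ab = a'b'`,
`cd = c'd'`, `ad+bc = a'd'+b'c'`, and (up to swapping) equality of the sums. -/
theorem abcd_arithmetic (a b c d a' b' c' d' : ℕ)
    (ha : 0 < a) (hb : 0 < b) (hc : 0 < c) (hd : 0 < d)
    (ha' : 0 < a') (hb' : 0 < b') (hc' : 0 < c') (hd' : 0 < d')
    (h₁ : a * b + c * d = a' * b' + c' * d')
    (h₂ : ((a : ℤ) + c - 2) * ((b : ℤ) + d - 2) =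
      ((a' : ℤ) + c' - 2) * ((b' : ℤ) + d' - 2))
    (h₃ : 4 * ((a : ℤ) * b) - ((a : ℤ) * d + (b : ℤ) * c) =
      4 * ((a' : ℤ) * b') - ((a' : ℤ) * d' + (b' : ℤ) * c'))
    (h₄ : 4 * ((c : ℤ) * d) - ((a : ℤ) * d + (b : ℤ) * c) =
      4 * ((c' : ℤ) * d') - ((a' : ℤ) * d' + (b' : ℤ) * c')) :
    a * b = a' * b' ∧ c * d = c' * d' ∧ a * d + b * c = a' * d' + b' * c' ∧
      ((a + c = a' + c' ∧ b + d = b' + d') ∨ (a + c = b' + d' ∧ b + d = a' + c')) := by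
  zify at h₁ ⊢
  have hab : (a : ℤ) * b = a' * b' := by linarith
  have hcd : (c : ℤ) * d = c' * d' := by linarith
  have hmix : (a : ℤ) * d + b * c = a' * d' + b' * c' := by linarith
  have hprod : ((a : ℤ) + c) * (b + d) = (a' + c') * (b' + d') := by linarith
  have hsum : ((a : ℤ) + c) + (b + d) = (a' + c') + (b' + d') := by linarith
  have hroot : ((a : ℤ) + c - (a' + c')) * ((a : ℤ) + c - (b' + d')) = 0 := by
    linear_combination ((a : ℤ) + c) * hsum - hprod
  refine ⟨hab, hcd, hmix, ?_⟩
  rcases mul_eq_zero.mp hroot with h | h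
  · left; constructor <;> linarith
  · right; constructor <;> linarith
end
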